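/- arXiv:1809.11083 — 3 statements merged into one kernel-verified Lean document; each statement's English description precedes it below -/
import Mathlib

section
/- Let A be the adjacency matrix of the path graph on n ≥ 2 vertices, i.e. a_ij = 1 if |i − j| = 1 and a_ij = 0 otherwise. Then θ ∈ R^n is a critical point of the energy E(θ) = (1/2)·Σ_{i,j} a_ij (1 − cos(θ_i − θ_j)) if and only if θ_{i+1} − θ_i ≡ 0 or π (mod 2π) for every 1 ≤ i ≤ n − 1. In particular, up to a global translation, the critical points are exactly the 2^{n−1} configurations with each θ_i ∈ {0, π} (mod 2π). -/
/-- The adjacency matrix of the path graph on `n` vertices: `a_ij = 1` iff `|i - j| = 1`. -/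
def pathAdj (n : ℕ) : Matrix (Fin n) (Fin n) ℝ :=
  Matrix.of fun i j => if (i : ℕ) + 1 = (j : ℕ) ∨ (j : ℕ) + 1 = (i : ℕ) then 1 else 0

/-- For the path graph on `n ≥ 2` vertices, `θ` is a critical point of the
energy `E` iff each consecutive difference `θ_{i+1} - θ_i` is `0` or `π` modulo `2π`,
i.e. an integer multiple of `π`. -/
theorem path_graph_critical_points {n : ℕ} (hn : 2 ≤ n) (θ : Fin n → ℝ) :
    (∀ i, ∑ j, pathAdj n i j * Real.sin (θ i - θ j) = 0) ↔
      (∀ i : Fin n, ∀ h : (i : ℕ) + 1 < n,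
        ∃ m : ℤ, θ ⟨(i : ℕ) + 1, h⟩ - θ i = m * Real.pi) := by
  have key : ∀ x : ℝ, Real.sin x = 0 ↔ ∃ m : ℤ, x = m * Real.pi := by
    intro x
    rw [Real.sin_eq_zero_iff]
    exact ⟨fun ⟨m, hm⟩ => ⟨m, hm.symm⟩, fun ⟨m, hm⟩ => ⟨m, hm.symm⟩⟩
  have hneg : ∀ x y : ℝ, Real.sin (x - y) = 0 → Real.sin (y - x) = 0 := by
    intro x y h
    rw [← neg_sub, Real.sin_neg, h, neg_zero]
  simp only [← key]
  constructor
  · intro H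
    have main : ∀ k : ℕ, ∀ h : k + 1 < n,
        Real.sin (θ ⟨k + 1, h⟩ - θ ⟨k, Nat.lt_of_succ_lt h⟩) = 0 := by
      intro k
      induction k using Nat.strong_induction_on with
      | _ k ih =>
        intro h
        have hk := H ⟨k, Nat.lt_of_succ_lt h⟩
        rw [Finset.sum_eq_single (⟨k + 1, h⟩ : Fin n)] at hk
        · simp only [pathAdj, Matrix.of_apply, true_or, if_true, one_mul] at hk
          exact hneg _ _ hk
        · rintro ⟨j, hj⟩ - hne
          simp only [pathAdj, Matrix.of_apply]
          split_ifs with hadj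
          · rcases hadj with e | e
            · exact absurd (Fin.ext e.symm) hne
            · subst e
              rw [one_mul]
              exact ih j (Nat.lt_succ_self j) _
          · rw [zero_mul]
        · intro hmem
          exact absurd (Finset.mem_univ _) hmem
    intro i h
    exact main i h
  · rintro H ⟨i, hi⟩
    apply Finset.sum_eq_zero
    rintro ⟨j, hj⟩ -
    simp only [pathAdj, Matrix.of_apply]
    split_ifs with hadj
    · rw [one_mul]
      rcases hadj with e | e
      · subst e
        exact hneg _ _ (H ⟨i, hi⟩ hj)
      · subst e
        exact H ⟨j, hj⟩ hi
    · rw [zero_mul]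
end

section
/- Let A ∈ {0,1}^{n×n} be the adjacency matrix (zero diagonal) of a graph in which every vertex has degree at least μ(n−1), and let θ ∈ R^n satisfy the second-order necessary condition ddiag(A Q Qᵀ) − A ∘ (Q Qᵀ) ⪰ 0, where Q ∈ R^{n×2} has i-th row (cos θ_i, sin θ_i). Then the order parameter r = Σ_{j=1}^n e^{iθ_j} ∈ C satisfies |r|² = ⟨J_n, Q Qᵀ⟩ ≥ (2μ − 3/2)·n² + 2(1 − μ)·n. -/
open Matrix

/-- The `n × 2` matrix whose `i`-th row is `(cos θ_i, sin θ_i)`. -/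
noncomputable def Qmat {n : ℕ} (θ : Fin n → ℝ) : Matrix (Fin n) (Fin 2) ℝ :=
  Matrix.of fun i k => if k = 0 then Real.cos (θ i) else Real.sin (θ i)

/-- The Hessian `ddiag(A Q Qᵀ) - A ∘ (Q Qᵀ)` of the energy function at `θ`. -/
noncomputable def hessE {n : ℕ} (A : Matrix (Fin n) (Fin n) ℝ) (θ : Fin n → ℝ) :
    Matrix (Fin n) (Fin n) ℝ :=
  Matrix.diagonal (fun i => (A * (Qmat θ * (Qmat θ)ᵀ)) i i) -
    A.hadamard (Qmat θ * (Qmat θ)ᵀ)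

/-- If every vertex of the graph `A` has degree at least `μ(n-1)` and `θ`
satisfies the second-order condition, then the order parameter `r = Σ_j e^{iθ_j}` satisfies
`|r|² = ⟨J_n, QQᵀ⟩ ≥ (2μ - 3/2) n² + 2(1-μ) n`. -/
theorem order_parameter_lower_bound {n : ℕ}
    (A : Matrix (Fin n) (Fin n) ℝ) (μ : ℝ)
    (hsymm : A.IsSymm) (hdiag : ∀ i, A i i = 0)
    (h01 : ∀ i j, A i j = 0 ∨ A i j = 1)
    (hdeg : ∀ i, μ * ((n : ℝ) - 1) ≤ ∑ j ∈ Finset.univ.erase i, A i j)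
    (θ : Fin n → ℝ)
    (hsec : (hessE A θ).PosSemidef) :
    ((∑ j, Real.cos (θ j)) ^ 2 + (∑ j, Real.sin (θ j)) ^ 2 =
        ∑ i, ∑ j, (Qmat θ * (Qmat θ)ᵀ) i j) ∧
      (2 * μ - 3 / 2) * (n : ℝ) ^ 2 + 2 * (1 - μ) * (n : ℝ) ≤
        (∑ j, Real.cos (θ j)) ^ 2 + (∑ j, Real.sin (θ j)) ^ 2 := by
  have hC : ∀ i j, (Qmat θ * (Qmat θ)ᵀ) i j = Real.cos (θ i - θ j) := by
    intro i j
    simp [Qmat, Matrix.mul_apply, Fin.sum_univ_two, Real.cos_sub]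
  have hr : ∀ φ : Fin n → ℝ, (∑ j, Real.cos (φ j)) ^ 2 + (∑ j, Real.sin (φ j)) ^ 2 =
      ∑ i, ∑ j, Real.cos (φ i - φ j) := by
    intro φ
    simp only [Real.cos_sub, Finset.sum_add_distrib, sq, Finset.sum_mul_sum]
  have hquad : ∀ x : Fin n → ℝ,
      0 ≤ ∑ i, ∑ j, A i j * Real.cos (θ i - θ j) * (x i * x i - x i * x j) := by
    intro x
    have h := hsec.dotProduct_mulVec_nonneg x
    have e : star x ⬝ᵥ (hessE A θ) *ᵥ x =
        ∑ i, ∑ j, A i j * Real.cos (θ i - θ j) * (x i * x i - x i * x j) := by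
      rw [hessE, Matrix.sub_mulVec, dotProduct_sub]
      have hd : ∀ i, (A * (Qmat θ * (Qmat θ)ᵀ)) i i =
          ∑ j, A i j * Real.cos (θ j - θ i) := by
        intro i
        rw [Matrix.mul_apply]
        simp only [hC]
      simp only [hd, dotProduct, Matrix.mulVec_diagonal]
      simp only [dotProduct, hC, Matrix.mulVec, Matrix.hadamard_apply, star_trivial,
        Matrix.diagonal_apply, ite_mul, zero_mul, Finset.sum_ite_eq, Finset.mem_univ, if_true]
      rw [← Finset.sum_sub_distrib]
      refine Finset.sum_congr rfl fun i _ => ?_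
      rw [Finset.sum_mul, Finset.mul_sum, Finset.mul_sum, ← Finset.sum_sub_distrib]
      refine Finset.sum_congr rfl fun j _ => ?_
      rw [← Real.cos_neg (θ j - θ i), neg_sub]
      ring
    rwa [e] at h
  have h1 : 0 ≤ ∑ i, ∑ j, A i j * Real.cos (θ i - θ j) * (1 - Real.cos (θ i - θ j)) := by
    have h := add_nonneg (hquad fun i => Real.cos (θ i)) (hquad fun i => Real.sin (θ i))
    simp only [← Finset.sum_add_distrib] at h
    refine h.trans_eq ?_
    refine Finset.sum_congr rfl fun i _ => Finset.sum_congr rfl fun j _ => ?_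
    rw [← Real.sin_sq_add_cos_sq (θ i)]
    simp only [Real.cos_sub]
    ring
  have h2 : (n : ℝ) ^ 2 / 2 ≤ ∑ i, ∑ j, Real.cos (θ i - θ j) ^ 2 := by
    have h := hr fun i => 2 * θ i
    have e : ∑ i, ∑ j, Real.cos (θ i - θ j) ^ 2 =
        ∑ i : Fin n, ∑ j : Fin n, ((1 : ℝ) / 2 + (1 / 2) * Real.cos (2 * θ i - 2 * θ j)) := by
      refine Finset.sum_congr rfl fun i _ => Finset.sum_congr rfl fun j _ => ?_
      rw [← mul_sub, Real.cos_two_mul]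
      ring
    rw [e]
    simp only [Finset.sum_add_distrib, ← Finset.mul_sum, ← h]
    simp only [Finset.sum_const, Finset.card_univ, Fintype.card_fin, nsmul_eq_mul]
    nlinarith [sq_nonneg (∑ j, Real.cos (2 * θ j)), sq_nonneg (∑ j, Real.sin (2 * θ j))]
  have h3 : (n : ℝ) * (μ * ((n : ℝ) - 1)) ≤ ∑ i, ∑ j, A i j := by
    have h : ∑ _i : Fin n, μ * ((n : ℝ) - 1) ≤ ∑ i, ∑ j, A i j := by
      refine Finset.sum_le_sum fun i _ => (hdeg i).trans_eq ?_
      exact Finset.sum_erase _ (hdiag i)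
    simpa using h
  have h4 : ∑ i, ∑ j, (A i j * Real.cos (θ i - θ j) * (1 - Real.cos (θ i - θ j))
        + Real.cos (θ i - θ j) ^ 2 + 2 * A i j + (if i = j then (2 : ℝ) else 0)) ≤
      ∑ i : Fin n, ∑ j : Fin n, (Real.cos (θ i - θ j) + 2) := by
    refine Finset.sum_le_sum fun i _ => Finset.sum_le_sum fun j _ => ?_
    by_cases hij : i = j
    · subst hij
      simp [hdiag]
    · rw [if_neg hij]
      have a := Real.neg_one_le_cos (θ i - θ j)
      have b := Real.cos_le_one (θ i - θ j)
      rcases h01 i j with h | h <;> rw [h] <;> nlinarith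
  simp only [Finset.sum_add_distrib, ← Finset.mul_sum, Finset.sum_ite_eq, Finset.mem_univ,
    if_true, Finset.sum_const, Finset.card_univ, Fintype.card_fin, nsmul_eq_mul] at h4
  simp only [hC]
  refine ⟨hr θ, ?_⟩
  rw [hr θ]
  nlinarith
end

section
/- Fix n ≥ 3 and 1 ≤ k ≤ (n−1)/2, let A_k be the circulant Wiley–Strogatz–Girvan adjacency matrix ((A_k)_{ij} = 1 iff 1 ≤ min(|i−j|, n−|i−j|) ≤ k), and let θ̃_l = 2πl/n be the twisted state. Then the Hessian L_k = ddiag(A_k Q Qᵀ) − A_k ∘ (Q Qᵀ) at θ̃ (with Q having l-th row (cos θ̃_l, sin θ̃_l)) is a symmetric circulant matrix whose n eigenvalues are λ_l(L_k) = 2·Σ_{j=1}^k cos(2πj/n) − 2·Σ_{j=1}^k cos(2πj/n)·cos(2π(l−1)j/n), for l = 1,…,n; in particular λ_2(L_k) = 2·Σ_{j=1}^k cos(2πj/n) − 2·Σ_{j=1}^k cos²(2πj/n). -/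
open Matrix Polynomial

/-- The circulant adjacency matrix of the Wiley–Strogatz–Girvan network on `n` nodes with
parameter `k`. -/
def wsgAdj (n k : ℕ) : Matrix (Fin n) (Fin n) ℝ :=
  Matrix.of fun i j =>
    if 1 ≤ min (Nat.dist (i : ℕ) (j : ℕ)) (n - Nat.dist (i : ℕ) (j : ℕ)) ∧
        min (Nat.dist (i : ℕ) (j : ℕ)) (n - Nat.dist (i : ℕ) (j : ℕ)) ≤ k
    then 1 else 0

/-- The twisted state `θ̃_l = 2πl/n`. -/
noncomputable def twisted (n : ℕ) : Fin n → ℝ := fun l => 2 * Real.pi * (l : ℕ) / n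

/-- The `n × 2` matrix whose `l`-th row is `(cos θ̃_l, sin θ̃_l)`. -/
noncomputable def Qtw (n : ℕ) : Matrix (Fin n) (Fin 2) ℝ :=
  Matrix.of fun l k => if k = 0 then Real.cos (twisted n l) else Real.sin (twisted n l)

/-- The Hessian `L_k = ddiag(A_k Q Qᵀ) - A_k ∘ (Q Qᵀ)` of the energy at the twisted state. -/
noncomputable def Lmat (n k : ℕ) : Matrix (Fin n) (Fin n) ℝ :=
  Matrix.diagonal (fun i => (wsgAdj n k * (Qtw n * (Qtw n)ᵀ)) i i) -
    (wsgAdj n k).hadamard (Qtw n * (Qtw n)ᵀ)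

/-- The claimed eigenvalues: for `l : Fin n` (0-based, corresponding to `l - 1` in the paper's
1-based indexing), `λ_l = 2 Σ_{j=1}^k cos(2πj/n) - 2 Σ_{j=1}^k cos(2πj/n) cos(2π l j/n)`. -/
noncomputable def wsgEig (n k : ℕ) (l : Fin n) : ℝ :=
  2 * ∑ j ∈ Finset.range k, Real.cos (2 * Real.pi * (j + 1) / n) -
    2 * ∑ j ∈ Finset.range k,
      Real.cos (2 * Real.pi * (j + 1) / n) * Real.cos (2 * Real.pi * (l : ℕ) * (j + 1) / n)

theorem val_sub_cases {n : ℕ} (i j : Fin n) :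
    ((j : ℕ) ≤ i ∧ ((i - j : Fin n) : ℕ) = i - j) ∨
      ((i : ℕ) < j ∧ ((i - j : Fin n) : ℕ) = n - j + i) := by
  have hi := i.isLt
  have hj := j.isLt
  rw [Fin.val_sub]
  rcases le_or_gt (j : ℕ) (i : ℕ) with h | h
  · left
    refine ⟨h, ?_⟩
    rw [Nat.mod_eq_sub_mod (by omega), Nat.mod_eq_of_lt (by omega)]
    omega
  · right
    exact ⟨h, Nat.mod_eq_of_lt (by omega)⟩

/-- The weight of the shift `d`. -/
def wsgC (n k d : ℕ) : ℝ := if 1 ≤ min d (n - d) ∧ min d (n - d) ≤ k then 1 else 0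

theorem wsgAdj_eq {n k : ℕ} (i j : Fin n) : wsgAdj n k i j = wsgC n k ((i - j : Fin n) : ℕ) := by
  have hi := i.isLt
  have hj := j.isLt
  unfold wsgAdj wsgC
  simp only [Matrix.of_apply]
  rcases val_sub_cases i j with ⟨h, e⟩ | ⟨h, e⟩
  · rw [e, Nat.dist_eq_sub_of_le_right h]
  · rw [e, Nat.dist_eq_sub_of_le h.le]
    have h1 : n - (n - (j : ℕ) + i) = j - i := by omega
    have h2 : n - ((j : ℕ) - i) = n - j + i := by omega
    rw [h1, h2, min_comm]

theorem cos_sub_eq {n : ℕ} (i j : Fin n) :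
    Real.cos (twisted n i - twisted n j) =
      Real.cos (2 * Real.pi * ((i - j : Fin n) : ℕ) / n) := by
  have hj := j.isLt
  have hn : (n : ℝ) ≠ 0 := by
    have : n ≠ 0 := by omega
    exact_mod_cast this
  unfold twisted
  rcases val_sub_cases i j with ⟨h, e⟩ | ⟨h, e⟩
  · rw [e, Nat.cast_sub h]
    congr 1
    ring
  · rw [e, Nat.cast_add, Nat.cast_sub hj.le, ← Real.cos_add_two_pi]
    congr 1
    field_simp
    ring

theorem QQ_eq {n : ℕ} (i j : Fin n) :
    (Qtw n * (Qtw n)ᵀ) i j = Real.cos (2 * Real.pi * ((i - j : Fin n) : ℕ) / n) := by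
  rw [← cos_sub_eq, Real.cos_sub]
  simp [Matrix.mul_apply, Fin.sum_univ_two, Qtw]

theorem sum_wsgC {n k : ℕ} (hk : 2 * k ≤ n - 1) (hn : 3 ≤ n) (g : ℕ → ℂ) :
    ∑ d : Fin n, (wsgC n k d : ℂ) * g d =
      ∑ m ∈ Finset.range k, (g (m + 1) + g (n - (m + 1))) := by
  rw [← Finset.sum_range (fun d => (wsgC n k d : ℂ) * g d)]
  have h1 : ∀ d ∈ Finset.range n, (wsgC n k d : ℂ) * g d =
      if d ∈ (Finset.Ico 1 (k + 1) ∪ Finset.Ico (n - k) n) then g d else 0 := by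
    intro d hd
    have hd := Finset.mem_range.1 hd
    unfold wsgC
    by_cases h : 1 ≤ min d (n - d) ∧ min d (n - d) ≤ k
    · rw [if_pos h, if_pos]
      · simp
      · simp only [Finset.mem_union, Finset.mem_Ico]; omega
    · rw [if_neg h, if_neg]
      · simp
      · simp only [Finset.mem_union, Finset.mem_Ico]; omega
  rw [Finset.sum_congr rfl h1, ← Finset.sum_filter]
  have h2 : (Finset.range n).filter (fun d => d ∈ (Finset.Ico 1 (k + 1) ∪ Finset.Ico (n - k) n))
      = Finset.Ico 1 (k + 1) ∪ Finset.Ico (n - k) n := by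
    ext d
    simp only [Finset.mem_filter, Finset.mem_union, Finset.mem_Ico, Finset.mem_range]
    omega
  rw [h2, Finset.sum_union, Finset.sum_add_distrib]
  · congr 1
    · rw [Finset.sum_Ico_eq_sum_range]
      simp [add_comm]
    · rw [Finset.sum_Ico_eq_sum_range, ← Finset.sum_range_reflect]
      have : n - (n - k) = k := by omega
      rw [this]
      refine Finset.sum_congr rfl fun m hm => ?_
      have := Finset.mem_range.1 hm
      congr 1
      omega
  · rw [Finset.disjoint_left]
    intro d
    simp only [Finset.mem_Ico]
    omega

/-- The common diagonal entry. -/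
noncomputable def wsgD (n k : ℕ) : ℝ :=
  ∑ d : Fin n, wsgC n k d * Real.cos (2 * Real.pi * (d : ℕ) / n)

theorem Lmat_apply {n k : ℕ} [NeZero n] (i j : Fin n) : Lmat n k i j =
    (if i - j = 0 then wsgD n k else 0) -
      wsgC n k ((i - j : Fin n) : ℕ) * Real.cos (2 * Real.pi * ((i - j : Fin n) : ℕ) / n) := by
  unfold Lmat
  rw [Matrix.sub_apply, Matrix.hadamard_apply, wsgAdj_eq, QQ_eq, Matrix.diagonal_apply]
  congr 1
  simp only [sub_eq_zero]
  split_ifs with h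
  · rw [Matrix.mul_apply, wsgD, ← Equiv.sum_comp (Equiv.subLeft i)]
    refine Finset.sum_congr rfl fun x _ => ?_
    rw [wsgAdj_eq, QQ_eq, ← cos_sub_eq, ← Real.cos_neg, neg_sub, cos_sub_eq]
    simp
  · rfl

theorem cos_refl {n m : ℕ} (h : m ≤ n) (hn : n ≠ 0) :
    Real.cos (2 * Real.pi * ((n - m : ℕ) : ℝ) / n) = Real.cos (2 * Real.pi * m / n) := by
  have hn : (n : ℝ) ≠ 0 := by exact_mod_cast hn
  rw [Nat.cast_sub h, ← Real.cos_two_pi_sub]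
  congr 1
  field_simp
  ring

/-- The standard root of unity. -/
noncomputable def wsgW (n : ℕ) : ℂ := Complex.exp (2 * Real.pi * Complex.I / n)

theorem wsgW_prim {n : ℕ} (hn : n ≠ 0) : IsPrimitiveRoot (wsgW n) n :=
  Complex.isPrimitiveRoot_exp n hn

theorem pow_val_add {n : ℕ} [NeZero n] (z : ℂ) (hz : z ^ n = 1) (a b : Fin n) :
    z ^ ((a + b : Fin n) : ℕ) = z ^ (a : ℕ) * z ^ (b : ℕ) := by
  rw [Fin.val_add, ← pow_add, ← pow_eq_pow_mod _ hz]

theorem wsgD_eq {n k : ℕ} (hn : 3 ≤ n) (hk2 : 2 * k ≤ n - 1) :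
    (wsgD n k : ℂ) =
      2 * ∑ j ∈ Finset.range k, (Real.cos (2 * Real.pi * (j + 1) / n) : ℂ) := by
  unfold wsgD
  rw [Complex.ofReal_sum]
  simp only [Complex.ofReal_mul]
  rw [sum_wsgC hk2 hn (fun d => (Real.cos (2 * Real.pi * (d : ℕ) / n) : ℂ)), Finset.mul_sum]
  refine Finset.sum_congr rfl fun m hm => ?_
  have := Finset.mem_range.1 hm
  rw [cos_refl (by omega) (by omega)]
  push_cast
  ring

theorem pow_pair {n : ℕ} (l m : ℕ) (hm : m ≤ n) (hn : n ≠ 0) :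
    (wsgW n ^ l) ^ m + (wsgW n ^ l) ^ (n - m) =
      2 * (Real.cos (2 * Real.pi * l * m / n) : ℂ) := by
  have hn' : (n : ℂ) ≠ 0 := by exact_mod_cast hn
  rw [Complex.ofReal_cos, Complex.two_cos]
  congr 1
  · rw [← pow_mul, wsgW, ← Complex.exp_nat_mul]
    congr 1
    push_cast
    field_simp
  · rw [← pow_mul, wsgW, ← Complex.exp_nat_mul, Complex.exp_eq_exp_iff_exists_int]
    refine ⟨l, ?_⟩
    push_cast [Nat.cast_sub hm]
    field_simp
    ring

theorem Lmat_mul {n k : ℕ} [NeZero n] (hn : 3 ≤ n) (hk2 : 2 * k ≤ n - 1) :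
    ((Lmat n k).map (algebraMap ℝ ℂ)) * (Matrix.vandermonde (fun l : Fin n => wsgW n ^ (l : ℕ)))ᵀ =
      (Matrix.vandermonde (fun l : Fin n => wsgW n ^ (l : ℕ)))ᵀ *
        Matrix.diagonal (fun l => (wsgEig n k l : ℂ)) := by
  ext i l
  rw [Matrix.mul_diagonal, Matrix.mul_apply]
  simp only [Matrix.transpose_apply, Matrix.vandermonde_apply, Matrix.map_apply, Lmat_apply]
  set z : ℂ := wsgW n ^ (l : ℕ) with hz
  have hzn : z ^ n = 1 := by
    rw [hz, ← pow_mul, mul_comm, pow_mul, (wsgW_prim (by omega)).pow_eq_one, one_pow]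
  rw [← Equiv.sum_comp (Equiv.subLeft i)]
  simp only [Equiv.subLeft_apply, sub_sub_cancel]
  have key : ∀ x : Fin n, z ^ ((i - x : Fin n) : ℕ) = z ^ (i : ℕ) * z ^ (n - (x : ℕ)) := by
    intro x
    have h1 := pow_val_add z hzn (i - x) x
    rw [sub_add_cancel] at h1
    rw [h1, mul_assoc, ← pow_add, Nat.add_sub_cancel' x.isLt.le, hzn, mul_one]
  simp only [key, map_sub, sub_mul, Finset.sum_sub_distrib]
  have e1 : ∑ x : Fin n, (algebraMap ℝ ℂ) (if x = 0 then wsgD n k else 0) *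
      (z ^ (i : ℕ) * z ^ (n - (x : ℕ))) = z ^ (i : ℕ) * wsgD n k := by
    rw [Finset.sum_eq_single 0]
    · simp [hzn, mul_comm]
    · intro b _ hb
      simp [hb]
    · simp
  have e2 : ∑ x : Fin n, (algebraMap ℝ ℂ)
      (wsgC n k x * Real.cos (2 * Real.pi * ((x : ℕ) : ℝ) / n)) *
      (z ^ (i : ℕ) * z ^ (n - (x : ℕ))) = z ^ (i : ℕ) *
        (2 * ∑ j ∈ Finset.range k, (Real.cos (2 * Real.pi * (j + 1) / n) : ℂ) *
          (Real.cos (2 * Real.pi * (l : ℕ) * (j + 1) / n) : ℂ)) := by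
    have := sum_wsgC hk2 hn (fun d => (Real.cos (2 * Real.pi * (d : ℕ) / n) : ℂ) * z ^ (n - d))
    calc _ = z ^ (i : ℕ) * ∑ x : Fin n, (wsgC n k x : ℂ) *
          ((Real.cos (2 * Real.pi * ((x : ℕ) : ℝ) / n) : ℂ) * z ^ (n - (x : ℕ))) := by
            rw [Finset.mul_sum]
            refine Finset.sum_congr rfl fun x _ => ?_
            rw [Complex.coe_algebraMap, Complex.ofReal_mul]
            ring
      _ = _ := by
            rw [this]
            congr 1
            rw [Finset.mul_sum]
            refine Finset.sum_congr rfl fun m hm => ?_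
            have hm := Finset.mem_range.1 hm
            rw [cos_refl (by omega) (by omega), Nat.sub_sub_self (by omega)]
            have hp := pow_pair (n := n) l (m + 1) (by omega) (by omega)
            rw [← hz] at hp
            push_cast at hp ⊢
            linear_combination (Complex.cos (2 * Real.pi * (m + 1) / n)) * hp
  rw [e1, e2, wsgD_eq hn hk2, ← mul_sub]
  congr 1
  unfold wsgEig
  push_cast
  rfl

/-- For `n ≥ 3`, `1 ≤ k ≤ (n-1)/2`, the Hessian `L_k` at the twisted state
is a symmetric circulant matrix whose `n` eigenvalues (with multiplicity, i.e. as roots of the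
characteristic polynomial over `ℂ`) are exactly the `λ_l` above; in particular the eigenvalue
corresponding to `l = 2` in 1-based indexing is
`2 Σ_{j=1}^k cos(2πj/n) - 2 Σ_{j=1}^k cos²(2πj/n)`. -/
theorem twisted_state_hessian_eigenvalues {n k : ℕ} (hn : 3 ≤ n)
    (hk1 : 1 ≤ k) (hk2 : 2 * k ≤ n - 1) :
    (Lmat n k).IsSymm ∧
      (∃ v : Fin n → ℝ, Lmat n k = Matrix.circulant v) ∧
      ((Lmat n k).map (algebraMap ℝ ℂ)).charpoly =
        ∏ l : Fin n, (X - C ((wsgEig n k l : ℝ) : ℂ)) ∧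
      wsgEig n k ⟨1, by omega⟩ =
        2 * ∑ j ∈ Finset.range k, Real.cos (2 * Real.pi * (j + 1) / n) -
          2 * ∑ j ∈ Finset.range k, Real.cos (2 * Real.pi * (j + 1) / n) ^ 2 := by
  have : NeZero n := ⟨by omega⟩
  refine ⟨?_, ⟨fun d => (if d = 0 then wsgD n k else 0) -
      wsgC n k (d : ℕ) * Real.cos (2 * Real.pi * (d : ℕ) / n), ?_⟩, ?_, ?_⟩
  · ext i j
    rw [Matrix.transpose_apply]
    have hA : ∀ i j : Fin n, wsgAdj n k i j = wsgAdj n k j i := by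
      intro i j
      simp only [wsgAdj, Matrix.of_apply, Nat.dist_comm]
    rw [Lmat_apply, Lmat_apply, ← wsgAdj_eq, ← wsgAdj_eq, ← cos_sub_eq, ← cos_sub_eq, hA j i,
      ← Real.cos_neg, neg_sub]
    simp only [sub_eq_zero, eq_comm]
  · ext i j
    rw [Lmat_apply, Matrix.circulant_apply]
  · set F := (Matrix.vandermonde (fun l : Fin n => wsgW n ^ (l : ℕ)))ᵀ with hF
    have hdet : F.det ≠ 0 := by
      rw [hF, Matrix.det_transpose, Matrix.det_vandermonde_ne_zero_iff]
      intro a b hab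
      exact Fin.ext ((wsgW_prim (by omega)).pow_inj a.isLt b.isLt hab)
    have hu : IsUnit F := (Matrix.isUnit_iff_isUnit_det F).2 hdet.isUnit
    obtain ⟨U, hU⟩ := hu
    have hM := Lmat_mul (n := n) (k := k) hn hk2
    rw [← hF, ← hU] at hM
    have hM2 : (Lmat n k).map (algebraMap ℝ ℂ) =
        U.val * Matrix.diagonal (fun l => (wsgEig n k l : ℂ)) * U⁻¹.val := by
      rw [← hM, mul_assoc, Units.mul_inv, mul_one]
    rw [hM2, Matrix.coe_units_inv, Matrix.charpoly_units_conj, Matrix.charpoly_diagonal]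
  · unfold wsgEig
    simp [pow_two]
end
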